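/- Let r ≥ 1, T > 0, and let f : ℂⁿ × ℝ → ℂⁿ satisfy f(z, t+T) = f(z, t), f(0, t) = 0, f(z, t) = f(−z, −t) for all z, t, and ‖f(z, t) − f(z', t)‖ ≤ L(t)·‖z − z'‖ with L : ℝ → ℝ continuous and nonnegative; let p : ℝ → ℂⁿ be continuous with p(t+T) = p(t) and p(−t) = p(t) for all t. Assume there exists c > 0 with ∫₀ᵀ max(c, c^{1−r}·L(t)) dt < 2π. If z₁ and z₂ are both r times continuously differentiable solutions of z^{(r)}(t) = f(z(t), t) + p(t) satisfying z_i(t) = −z_i(−t) and z_i(t+T) = z_i(t) for all t (i = 1, 2), then z₁ = z₂. -/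

import Mathlib

section Aux
open Set

theorem aux_one_step {E : Type*} [NormedAddCommGroup E] [NormedSpace ℝ E] {a b : ℝ} (hab : a < b)
    (g g1 g2 : ℝ → E) (Z Z1 Z2 : ℝ → ℝ)
    (hg : ∀ t, HasDerivAt g (g1 t) t) (hg1 : ∀ t, HasDerivAt g1 (g2 t) t)
    (hZc : ContinuousOn Z (Icc a b))
    (hZ : ∀ t ∈ Ioo a b, HasDerivAt Z (Z1 t) t) (hZ1 : ∀ t ∈ Ioo a b, HasDerivAt Z1 (Z2 t) t)
    (hle : ∀ t ∈ Ioo a b, ‖g2 t‖ ≤ - Z2 t)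
    (ga : g a = 0) (gb : g b = 0) (Za : 0 < Z a) (Zb : 0 < Z b) :
    ∀ t ∈ Icc a b, ‖g t‖ < Z t := by
  intro t ht
  obtain ⟨φ, hφ, hφt⟩ := exists_dual_vector'' ℝ (g t)
  have hconc : ConcaveOn ℝ (Icc a b) (fun s => Z s - φ (g s)) := by
    apply concaveOn_of_hasDerivWithinAt2_nonpos (convex_Icc a b)
      (f' := fun s => Z1 s - φ (g1 s)) (f'' := fun s => Z2 s - φ (g2 s))
    · apply hZc.sub
      apply Continuous.continuousOn
      exact φ.continuous.comp (continuous_iff_continuousAt.2 fun s => (hg s).continuousAt)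
    · rw [interior_Icc]
      intro s hs
      exact ((hZ s hs).sub (φ.hasFDerivAt.comp_hasDerivAt s (hg s))).hasDerivWithinAt
    · rw [interior_Icc]
      intro s hs
      exact ((hZ1 s hs).sub (φ.hasFDerivAt.comp_hasDerivAt s (hg1 s))).hasDerivWithinAt
    · rw [interior_Icc]
      intro s hs
      have h1 : |φ (g2 s)| ≤ ‖g2 s‖ := by
        have := φ.le_of_opNorm_le hφ (g2 s)
        simpa using this
      have h2 := neg_abs_le (φ (g2 s))
      have h3 := hle s hs
      show Z2 s - φ (g2 s) ≤ 0
      linarith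
  have hmin := hconc.min_le_of_mem_Icc (left_mem_Icc.2 hab.le) (right_mem_Icc.2 hab.le) ht
  simp only [ga, gb, map_zero, sub_zero, hφt] at hmin
  have : 0 < min (Z a) (Z b) := lt_min Za Zb
  have h5 : (RCLike.ofReal ‖g t‖ : ℝ) = ‖g t‖ := rfl
  rw [h5] at hmin
  linarith

theorem aux_sup {E : Type*} [NormedAddCommGroup E] {a b : ℝ} (hab : a < b) (k : ℕ)
    (v : ℕ → ℝ → E) (Y : ℕ → ℝ → ℝ)
    (hv : ∀ i ≤ k, ContinuousOn (v i) (Icc a b))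
    (hY : ∀ i ≤ k, ContinuousOn (Y i) (Icc a b))
    (hpos : ∀ i ≤ k, ∀ t ∈ Icc a b, 0 < Y i t)
    (H : ∀ K > 0, (∀ i ≤ k, ∀ t ∈ Icc a b, ‖v i t‖ ≤ K * Y i t) →
      ∀ i ≤ k, ∀ t ∈ Icc a b, ‖v i t‖ < K * Y i t) :
    ∀ t ∈ Icc a b, v 0 t = 0 := by
  have hmax : ∀ i, ∃ s ∈ Icc a b, i ≤ k → ∀ t ∈ Icc a b, ‖v i t‖ / Y i t ≤ ‖v i s‖ / Y i s := by
    intro i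
    by_cases hi : i ≤ k
    · obtain ⟨s, hs, hm⟩ := isCompact_Icc.exists_isMaxOn (nonempty_Icc.2 hab.le)
        ((hv i hi).norm.div (hY i hi) (fun t ht => (hpos i hi t ht).ne'))
      exact ⟨s, hs, fun _ t ht => hm ht⟩
    · exact ⟨a, left_mem_Icc.2 hab.le, fun h => absurd h hi⟩
  choose s hs hm using hmax
  obtain ⟨j, hj, hjm⟩ := Finset.exists_max_image (Finset.range (k+1))
    (fun i => ‖v i (s i)‖ / Y i (s i)) ⟨0, by simp⟩
  have hj' : j ≤ k := by simpa [Nat.lt_succ_iff] using hj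
  set K := ‖v j (s j)‖ / Y j (s j) with hK
  have hle : ∀ i ≤ k, ∀ t ∈ Icc a b, ‖v i t‖ ≤ K * Y i t := by
    intro i hi t ht
    have h1 := (hm i hi t ht).trans (hjm i (by simp; omega))
    exact (div_le_iff₀ (hpos i hi t ht)).1 h1
  rcases le_or_gt K 0 with h0 | h0
  · intro t ht
    have h1 := hle 0 (Nat.zero_le _) t ht
    have h2 := mul_nonpos_of_nonpos_of_nonneg h0 (hpos 0 (Nat.zero_le _) t ht).le
    exact norm_le_zero_iff.1 (h1.trans h2)
  · exfalso
    have h1 := H K h0 hle j hj' (s j) (hs j)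
    rw [hK, div_mul_cancel₀ _ (hpos j hj' (s j) (hs j)).ne'] at h1
    exact lt_irrefl _ h1

/-- The supersolution for the even case. -/
theorem aux_Y {a b c : ℝ} (hab : a < b) (hc : 0 < c) (N : ℝ → ℝ) (hN : Continuous N)
    (hcN : ∀ t, c ≤ N t) (hS : ∫ t in a..b, N t < Real.pi) :
    ∃ Y Y1 Y2 : ℝ → ℝ, Continuous Y ∧ (∀ t, 0 < Y t) ∧
      (∀ t ∈ Ioo a b, HasDerivAt Y (Y1 t) t) ∧ (∀ t ∈ Ioo a b, HasDerivAt Y1 (Y2 t) t) ∧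
      (∀ t ∈ Ioo a b, c * N t * Y t ≤ - Y2 t) := by
  set S := ∫ t in a..b, N t with hSdef
  set ε := (Real.pi - S) / 2 with hε
  have hε0 : 0 < ε := by rw [hε]; linarith
  set θ : ℝ → ℝ := fun t => ε + ∫ s in a..t, N s with hθ
  have hθd : ∀ t, HasDerivAt θ (N t) t := fun t => by
    exact (hN.integral_hasStrictDerivAt a t).hasDerivAt.const_add ε
  have hθc : Continuous θ := continuous_iff_continuousAt.2 fun t => (hθd t).continuousAt
  have hmono : StrictMono θ := strictMono_of_hasDerivAt_pos hθd
    (fun t => hc.trans_le (hcN t))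
  have hθa : θ a = ε := by simp [hθ]
  have hθb : θ b = Real.pi - ε := by simp only [hθ]; rw [← hSdef, hε]; ring
  have hsε : 0 < Real.sin ε := Real.sin_pos_of_pos_of_lt_pi hε0 (by
    have := hmono hab; linarith)
  have hsin : ∀ t ∈ Ioo a b, Real.sin ε ≤ Real.sin (θ t) := by
    intro t ht
    have h1 := hmono ht.1
    have h2 := hmono ht.2
    rcases le_total (θ t) (Real.pi/2) with h | h
    · exact Real.sin_le_sin_of_le_of_le_pi_div_two (by linarith [Real.pi_pos]) h (by linarith)
    · rw [← Real.sin_pi_sub (θ t)]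
      exact Real.sin_le_sin_of_le_of_le_pi_div_two (by linarith [Real.pi_pos]) (by linarith) (by linarith)
  set C : ℝ → ℝ := fun t => c * Real.cos (θ t) / max (Real.sin (θ t)) (Real.sin ε) with hC
  have hCc : Continuous C := by
    apply Continuous.div
    · fun_prop
    · fun_prop
    · intro t; exact (hsε.trans_le (le_max_right _ _)).ne'
  set Y : ℝ → ℝ := fun t => Real.exp (∫ s in a..t, C s) with hY
  have hYd : ∀ t, HasDerivAt Y (Y t * C t) t := fun t =>
    (hCc.integral_hasStrictDerivAt a t).hasDerivAt.exp
  have hCd : ∀ t ∈ Ioo a b, HasDerivAt C (- (c * N t) / (Real.sin (θ t))^2) t := by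
    intro t ht
    have hs0 : 0 < Real.sin (θ t) := hsε.trans_le (hsin t ht)
    have h1 : HasDerivAt (fun t => c * Real.cos (θ t) / Real.sin (θ t))
        (- (c * N t) / (Real.sin (θ t))^2) t := by
      have := (((hθd t).cos).const_mul c).div ((hθd t).sin) hs0.ne'
      have h2 := Real.sin_sq_add_cos_sq (θ t)
      have e : (c * (-Real.sin (θ t) * N t) * Real.sin (θ t)
          - c * Real.cos (θ t) * (Real.cos (θ t) * N t)) / Real.sin (θ t) ^ 2
          = - (c * N t) / (Real.sin (θ t))^2 := by
        rw [show -(c * N t) = -(c * N t) * (Real.sin (θ t) ^ 2 + Real.cos (θ t) ^ 2) by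
          rw [h2, mul_one]]
        ring
      rw [← e]
      exact this
    apply h1.congr_of_eventuallyEq
    filter_upwards [isOpen_Ioo.mem_nhds ht] with s hs
    simp only [hC]
    rw [max_eq_left (hsin s hs)]
  refine ⟨Y, fun t => Y t * C t, fun t => Y t * C t * C t + Y t * (- (c * N t) / (Real.sin (θ t))^2),
    continuous_iff_continuousAt.2 fun t => (hYd t).continuousAt, fun t => Real.exp_pos _,
    fun t _ => hYd t, fun t ht => (hYd t).mul (hCd t ht), ?_⟩
  intro t ht
  have hs0 : 0 < Real.sin (θ t) := hsε.trans_le (hsin t ht)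
  have hY0 : 0 < Y t := Real.exp_pos _
  have hCt : C t = c * Real.cos (θ t) / Real.sin (θ t) := by
    simp only [hC]
    rw [max_eq_left (hsin t ht)]
  have key : c * N t ≤ -(C t * C t - (c * N t) / (Real.sin (θ t))^2) := by
    rw [hCt]
    have : -(c * Real.cos (θ t) / Real.sin (θ t) * (c * Real.cos (θ t) / Real.sin (θ t)) - (c * N t) / (Real.sin (θ t))^2) = (c * N t - c^2 * Real.cos (θ t)^2)/ (Real.sin (θ t))^2 := by
      field_simp
      ring
    rw [this, le_div_iff₀ (by positivity)]
    have h2 := Real.sin_sq_add_cos_sq (θ t)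
    have h3 : Real.sin (θ t)^2 = 1 - Real.cos (θ t)^2 := by linarith
    rw [h3]
    have h4 : 0 ≤ c * (N t - c) * Real.cos (θ t)^2 :=
      mul_nonneg (mul_nonneg hc.le (by linarith [hcN t])) (sq_nonneg _)
    nlinarith
  have := mul_le_mul_of_nonneg_left key hY0.le
  have e : -(Y t * C t * C t + Y t * (- (c * N t) / (Real.sin (θ t))^2)) = Y t * -(C t * C t - (c * N t) / (Real.sin (θ t))^2) := by ring
  rw [e]
  linarith

set_option maxHeartbeats 1000000 in
/-- The elementary inequality for the odd case. -/
theorem aux_ineq {x α κ e1 e2 : ℝ} (hx : 0 < x) (hx2 : x ≤ Real.pi / 2) (hα : 0 < α) (hα2 : α ≤ x)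
    (hκ : 1 ≤ κ) (he1 : 0 ≤ e1) (he2 : 0 ≤ e2) (he : e1 + e2 ≤ Real.pi * (1 - 1 / κ)) :
    (Real.cos α - Real.cos x) / κ + e1 * Real.sin x < κ ^ 2 * Real.sin x ∨
    (Real.cos α + Real.cos x) / κ + e2 < κ ^ 2 * Real.sin x := by
  have hκ0 : 0 < κ := by linarith
  have hpi := Real.pi_gt_d2
  have hpi2 := Real.pi_lt_d2
  have hcα : Real.cos α < 1 := by
    rw [← Real.cos_zero]
    exact Real.cos_lt_cos_of_nonneg_of_le_pi_div_two le_rfl (by linarith) hα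
  obtain ⟨σ, hσ⟩ : ∃ σ, σ = Real.sin x := ⟨_, rfl⟩
  obtain ⟨γ, hγ⟩ : ∃ γ, γ = Real.cos x := ⟨_, rfl⟩
  have hσ0 : 0 < σ := hσ ▸ Real.sin_pos_of_pos_of_lt_pi hx (by linarith)
  have hγ0 : 0 ≤ γ := hγ ▸ Real.cos_nonneg_of_mem_Icc ⟨by linarith, hx2⟩
  have hsq : σ^2 + γ^2 = 1 := by rw [hσ, hγ]; exact Real.sin_sq_add_cos_sq x
  rw [← hσ, ← hγ]
  obtain ⟨y, hy⟩ : ∃ y, y = κ - 1 := ⟨_, rfl⟩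
  have hy0 : 0 ≤ y := by linarith
  have hκy : κ = 1 + y := by linarith
  have heκ : κ * (e1 + e2) ≤ Real.pi * y := by
    have := mul_le_mul_of_nonneg_left he hκ0.le
    have h2 : κ * (Real.pi * (1 - 1/κ)) = Real.pi * (κ - 1) := by field_simp
    rw [h2] at this
    rwa [hy]
  have hpy : Real.pi * y ≤ 3.15 * y := by nlinarith
  have hl : ∀ p q : ℝ, p + κ * q < κ^3 * σ → p / κ + q < κ^2 * σ := by
    intro p q h
    rw [div_add' _ _ _ hκ0.ne', div_lt_iff₀ hκ0]
    nlinarith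
  by_contra hcon
  push Not at hcon
  obtain ⟨h1, h2⟩ := hcon
  have h1' : κ^3 * σ ≤ Real.cos α - γ + κ * (e1 * σ) := by
    by_contra hh
    push Not at hh
    exact absurd (hl _ _ hh) (not_lt.2 h1)
  have h2' : κ^3 * σ ≤ Real.cos α + γ + κ * e2 := by
    by_contra hh
    push Not at hh
    exact absurd (hl _ _ hh) (not_lt.2 h2)
  have hσ1 : σ ≤ 1 := by nlinarith
  -- first alternative
  have A : κ^3 * σ < 1 - γ + 3.15 * y * σ := by
    have : κ * (e1 * σ) ≤ 3.15 * y * σ := by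
      have : κ * e1 ≤ 3.15 * y := by nlinarith [mul_nonneg hκ0.le he2]
      nlinarith
    linarith
  have B : 2 * (κ^3 * σ) < 2 + 3.15 * y := by
    have : κ * (e1 * σ) ≤ κ * e1 := by
      apply mul_le_mul_of_nonneg_left _ hκ0.le
      nlinarith
    nlinarith
  have hk3 : 1 + 3 * y + 3 * y^2 ≤ κ^3 := by rw [hκy]; nlinarith [pow_nonneg hy0 3]
  have hk3s := mul_le_mul_of_nonneg_right hk3 hσ0.le
  have A' : (1 - 0.15 * y + 3 * y^2) * σ < 1 - γ := by linarith
  have B' : (1 + 3 * y + 3*y^2) * σ < 1 + 1.575 * y := by linarith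
  clear h1 h2 h1' h2' A B hl hk3 hk3s he heκ hpy hcα hκy hy
  have hγ1 : γ < 1 := by nlinarith
  have hg : 1 - γ ≤ σ := by nlinarith
  have hylt : y < 0.05 := by
    by_contra h
    push Not at h
    nlinarith [mul_nonneg (mul_nonneg hy0 (sub_nonneg.2 h)) hσ0.le]
  have hγs : γ < 0.16 * y := by
    have h1 : (1 - 0.15 * y) * σ < 1 - γ := by nlinarith [mul_nonneg (sq_nonneg y) hσ0.le]
    have h2 : ((1 - 0.15 * y) * σ)^2 < (1 - γ)^2 :=
      pow_lt_pow_left₀ h1 (mul_nonneg (by linarith) hσ0.le) two_ne_zero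
    have h3 : (1 - γ) * ((1 - 0.15 * y)^2 * (1 + γ)) < (1 - γ) * (1 - γ) := by
      have : ((1 - 0.15 * y) * σ)^2 = (1 - γ) * ((1 - 0.15 * y)^2 * (1 + γ)) := by
        linear_combination (1 - 0.15 * y)^2 * hsq
      rw [← this, ← sq]; exact h2
    have h4 := lt_of_mul_lt_mul_left h3 (by linarith)
    have h5 : (1 - 0.3 * y) * (1 + γ) ≤ (1 - 0.15 * y)^2 * (1 + γ) :=
      mul_le_mul_of_nonneg_right (by nlinarith [sq_nonneg y]) (by linarith)
    nlinarith
  have h6 : γ^2 ≤ (0.16 * y)^2 := pow_le_pow_left₀ hγ0 hγs.le 2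
  have h7 : σ^2 ≤ σ := by rw [sq]; exact mul_le_of_le_one_left hσ0.le hσ1
  have h8 : 1 - (0.16 * y)^2 ≤ σ := by linarith
  have h9 : (1 + 3 * y) * (1 - (0.16 * y)^2) ≤ (1 + 3 * y) * σ :=
    mul_le_mul_of_nonneg_left h8 (by linarith)
  have h10 : 0 ≤ y^2 * σ := mul_nonneg (sq_nonneg y) hσ0.le
  have h11 : y^2 ≤ 0.05 * y := by rw [sq]; exact mul_le_mul_of_nonneg_right hylt.le hy0
  have h12 : y^3 ≤ 0.05 * y^2 := by
    rw [pow_succ, mul_comm]; exact mul_le_mul_of_nonneg_right hylt.le (sq_nonneg y)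
  ring_nf at h9 B' h10
  linarith

theorem aux_first {E : Type*} [NormedAddCommGroup E] [NormedSpace ℝ E] [CompleteSpace E]
    (g g1 : ℝ → E) (hg : ∀ t, HasDerivAt g (g1 t) t) (hg1 : Continuous g1)
    (B : ℝ → ℝ) (hB : Continuous B) {p q : ℝ} (hpq : p ≤ q)
    (hle : ∀ t ∈ Icc p q, ‖g1 t‖ ≤ B t) : ‖g q - g p‖ ≤ ∫ t in p..q, B t := by
  rw [← intervalIntegral.integral_eq_sub_of_hasDerivAt (fun t _ => hg t)
    (hg1.intervalIntegrable _ _)]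
  refine (intervalIntegral.norm_integral_le_integral_norm hpq).trans ?_
  exact intervalIntegral.integral_mono_on hpq (hg1.norm.intervalIntegrable _ _)
    (hB.intervalIntegrable _ _) hle

theorem aux_min {a b c : ℝ} (hab : a < b) (hc : 0 < c) (N : ℝ → ℝ) (hN : Continuous N)
    (hcN : ∀ t, c ≤ N t) (hS : ∫ t in a..b, N t < Real.pi) :
    ∃ α β : ℝ, c ≤ β ∧ (∀ t ∈ Icc a b, 0 < Real.sin (α + β * (t - a))) ∧
      ∀ t ∈ Icc a b,
        (∫ s in a..t, N s * Real.sin (α + β * (s - a)))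
          < (β / c) ^ 2 * Real.sin (α + β * (t - a)) ∨
        (∫ s in t..b, N s * Real.sin (α + β * (s - a)))
          < (β / c) ^ 2 * Real.sin (α + β * (t - a)) := by
  obtain ⟨S, hSdef⟩ : ∃ S, S = ∫ t in a..b, N t := ⟨_, rfl⟩
  rw [← hSdef] at hS
  have hM : 0 < b - a := by linarith
  have hcS : c * (b - a) ≤ S := by
    have h1 : ∫ t in a..b, c ≤ ∫ t in a..b, N t :=
      intervalIntegral.integral_mono_on hab.le (continuous_const.intervalIntegrable _ _)
        (hN.intervalIntegrable _ _) (fun t _ => hcN t)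
    rw [intervalIntegral.integral_const, smul_eq_mul, ← hSdef] at h1
    linarith
  obtain ⟨α, hα⟩ : ∃ α, α = (Real.pi - S) / 2 := ⟨_, rfl⟩
  obtain ⟨β, hβ⟩ : ∃ β, β = S / (b - a) := ⟨_, rfl⟩
  have hα0 : 0 < α := by rw [hα]; linarith
  have hcβ : c ≤ β := by rw [hβ, le_div_iff₀ hM]; exact hcS
  have hβ0 : 0 < β := hc.trans_le hcβ
  have hβM : β * (b - a) = S := by rw [hβ]; field_simp
  have hx : ∀ t ∈ Icc a b, α ≤ α + β * (t - a) ∧ α + β * (t - a) ≤ Real.pi - α := by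
    intro t ht
    have h1 : 0 ≤ β * (t - a) := mul_nonneg hβ0.le (by linarith [ht.1])
    have h2 : 0 ≤ β * (b - t) := mul_nonneg hβ0.le (by linarith [ht.2])
    constructor
    · linarith
    · have : β * (t - a) + β * (b - t) = S := by rw [← hβM]; ring
      linarith
  have hκ : 1 ≤ β / c := by rw [le_div_iff₀ hc]; linarith
  have hpiece : ∀ p q m : ℝ, p ≤ q → (∀ s ∈ Icc p q, Real.sin (α + β * (s - a)) ≤ m) →
      (∫ s in p..q, N s * Real.sin (α + β * (s - a))) ≤
        (Real.cos (α + β * (p - a)) - Real.cos (α + β * (q - a))) / (β / c)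
          + (∫ s in p..q, (N s - c)) * m := by
    intro p q m hpq hm
    have hd : ∀ s, HasDerivAt (fun s => - Real.cos (α + β * (s - a)) / (β / c))
        (c * Real.sin (α + β * (s - a))) s := by
      intro s
      have h1 : HasDerivAt (fun s => α + β * (s - a)) β s := by
        simpa using (((hasDerivAt_id s).sub_const a).const_mul β).const_add α
      have h2 := (h1.cos.neg).div_const (β / c)
      have e : - (- Real.sin (α + β * (s - a)) * β) / (β / c) = c * Real.sin (α + β * (s - a)) := by
        field_simp
      rw [← e]
      exact h2
    have hi := intervalIntegral.integral_eq_sub_of_hasDerivAt (a := p) (b := q) (fun s _ => hd s)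
      (Continuous.intervalIntegrable (by fun_prop) _ _)
    have h3 : (∫ s in p..q, N s * Real.sin (α + β * (s - a))) =
        (∫ s in p..q, c * Real.sin (α + β * (s - a))) +
        ∫ s in p..q, (N s - c) * Real.sin (α + β * (s - a)) := by
      rw [← intervalIntegral.integral_add (Continuous.intervalIntegrable (by fun_prop) _ _)
        (Continuous.intervalIntegrable (by fun_prop) _ _)]
      congr 1
      ext s
      ring
    have h4 : (∫ s in p..q, (N s - c) * Real.sin (α + β * (s - a))) ≤
        ∫ s in p..q, (N s - c) * m :=
      intervalIntegral.integral_mono_on hpq (Continuous.intervalIntegrable (by fun_prop) _ _)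
        (Continuous.intervalIntegrable (by fun_prop) _ _)
        (fun s hs => mul_le_mul_of_nonneg_left (hm s hs) (by linarith [hcN s]))
    rw [intervalIntegral.integral_mul_const] at h4
    rw [h3, hi]
    have e2 : - Real.cos (α + β * (q - a)) / (β / c) - - Real.cos (α + β * (p - a)) / (β / c)
      = (Real.cos (α + β * (p - a)) - Real.cos (α + β * (q - a))) / (β / c) := by ring
    rw [e2]
    linarith
  refine ⟨α, β, hcβ, ?_, ?_⟩
  · intro t ht
    have := hx t ht
    exact Real.sin_pos_of_pos_of_lt_pi (by linarith) (by linarith)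
  intro t ht
  obtain ⟨hx1, hx2⟩ := hx t ht
  have he1 : 0 ≤ ∫ s in a..t, (N s - c) :=
    intervalIntegral.integral_nonneg ht.1 (fun s _ => by linarith [hcN s])
  have he2 : 0 ≤ ∫ s in t..b, (N s - c) :=
    intervalIntegral.integral_nonneg ht.2 (fun s _ => by linarith [hcN s])
  have hsum : (∫ s in a..t, (N s - c)) + (∫ s in t..b, (N s - c)) ≤
      Real.pi * (1 - 1 / (β / c)) := by
    rw [intervalIntegral.integral_add_adjacent_intervals
      (Continuous.intervalIntegrable (by fun_prop) _ _)
      (Continuous.intervalIntegrable (by fun_prop) _ _),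
      intervalIntegral.integral_sub (hN.intervalIntegrable _ _)
      (continuous_const.intervalIntegrable _ _), intervalIntegral.integral_const, smul_eq_mul,
      ← hSdef]
    have e : S - (b - a) * c = S * (1 - 1 / (β / c)) := by
      rw [← hβM]; field_simp
    rw [e]
    apply mul_le_mul_of_nonneg_right hS.le
    have : 1 / (β / c) ≤ 1 := by rw [div_le_one (by positivity)]; exact hκ
    linarith
  have hxa : α + β * (a - a) = α := by ring
  have hxb : α + β * (b - a) = Real.pi - α := by rw [hβM, hα]; ring
  rcases le_total (α + β * (t - a)) (Real.pi / 2) with h | h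
  · have h1 := hpiece a t (Real.sin (α + β * (t - a))) ht.1 (by
      intro s hs
      have h2 : β * (s - a) ≤ β * (t - a) := mul_le_mul_of_nonneg_left (by linarith [hs.2]) hβ0.le
      have h3 := (hx s ⟨hs.1, hs.2.trans ht.2⟩).1
      exact Real.sin_le_sin_of_le_of_le_pi_div_two (by linarith [Real.pi_pos]) h (by linarith))
    have h2 := hpiece t b 1 ht.2 (fun s _ => Real.sin_le_one _)
    rw [hxa] at h1
    rw [hxb, Real.cos_pi_sub, mul_one] at h2
    rcases aux_ineq (hα0.trans_le hx1) h hα0 hx1 hκ he1 he2 hsum with h3 | h3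
    · left; linarith
    · right
      have e : Real.cos (α + β * (t - a)) - - Real.cos α
        = Real.cos α + Real.cos (α + β * (t - a)) := by ring
      rw [e] at h2
      linarith
  · have h1 := hpiece t b (Real.sin (α + β * (t - a))) ht.2 (by
      intro s hs
      have h2 : β * (t - a) ≤ β * (s - a) := mul_le_mul_of_nonneg_left (by linarith [hs.1]) hβ0.le
      have h3 := (hx s ⟨ht.1.trans hs.1, hs.2⟩).2
      rw [← Real.sin_pi_sub, ← Real.sin_pi_sub (α + β * (t - a))]
      exact Real.sin_le_sin_of_le_of_le_pi_div_two (by linarith [Real.pi_pos])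
        (by linarith) (by linarith))
    have h2 := hpiece a t 1 ht.1 (fun s _ => Real.sin_le_one _)
    rw [hxa, mul_one] at h2
    rw [hxb, Real.cos_pi_sub] at h1
    have h4 := aux_ineq (x := Real.pi - (α + β * (t - a))) (by linarith) (by linarith) hα0
      (by linarith) hκ he2 he1 (by linarith)
    rw [Real.cos_pi_sub, Real.sin_pi_sub] at h4
    rcases h4 with h3 | h3
    · right
      have e : Real.cos (α + β * (t - a)) - - Real.cos α
        = Real.cos α - - Real.cos (α + β * (t - a)) := by ring
      rw [e] at h1
      linarith
    · left
      have e : Real.cos α - Real.cos (α + β * (t - a))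
        = Real.cos α + - Real.cos (α + β * (t - a)) := by ring
      rw [e] at h2
      linarith

theorem aux_core {E : Type*} [NormedAddCommGroup E] [NormedSpace ℝ E] [CompleteSpace E]
    {a b c : ℝ} (hab : a < b) (hc : 0 < c) (N : ℝ → ℝ) (hN : Continuous N)
    (hcN : ∀ t, c ≤ N t) (hS : ∫ t in a..b, N t < Real.pi)
    (r : ℕ) (hr : 1 ≤ r) (U : ℕ → ℝ → E)
    (hU : ∀ i < r, ∀ t, HasDerivAt (U i) (U (i + 1) t) t) (hUr : Continuous (U r))
    (hUa : ∀ i, 2 * i < r → U (2 * i) a = 0) (hUb : ∀ i, 2 * i < r → U (2 * i) b = 0)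
    (hle : ∀ t, ‖U r t‖ ≤ c ^ (r - 1) * N t * ‖U 0 t‖) :
    ∀ t ∈ Icc a b, U 0 t = 0 := by
  have hUc : ∀ i < r, Continuous (U i) := fun i hi =>
    continuous_iff_continuousAt.2 fun t => (hU i hi t).continuousAt
  have hN0 : ∀ t, 0 < N t := fun t => hc.trans_le (hcN t)
  have haI : a ∈ Icc a b := left_mem_Icc.2 hab.le
  have hbI : b ∈ Icc a b := right_mem_Icc.2 hab.le
  rcases Nat.even_or_odd' r with ⟨k, hk | hk⟩
  · -- even case
    obtain ⟨Y, Y1, Y2, hYc, hYpos, hYd, hY1d, hY2⟩ := aux_Y hab hc N hN hcN hS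
    apply aux_sup hab (k - 1) (fun i => U (2 * i)) (fun i t => c ^ (2 * i) * Y t)
    · intro i hi
      exact (hUc _ (by omega)).continuousOn
    · intro i hi
      exact (continuous_const.mul hYc).continuousOn
    · intro i hi t ht
      exact mul_pos (pow_pos hc _) (hYpos t)
    · intro K hK hb i hi
      have hlt : 2 * i + 1 < r := by omega
      apply aux_one_step hab (U (2 * i)) (U (2 * i + 1)) (U (2 * i + 1 + 1))
        (fun t => K * (c ^ (2 * i) * Y t)) (fun t => K * (c ^ (2 * i) * Y1 t))
        (fun t => K * (c ^ (2 * i) * Y2 t)) (hU _ (by omega)) (hU _ hlt)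
        (continuous_const.mul (continuous_const.mul hYc)).continuousOn
        (fun t ht => ((hYd t ht).const_mul _).const_mul _)
        (fun t ht => ((hY1d t ht).const_mul _).const_mul _) _
        (hUa i (by omega)) (hUb i (by omega))
        (mul_pos hK (mul_pos (pow_pos hc _) (hYpos a)))
        (mul_pos hK (mul_pos (pow_pos hc _) (hYpos b)))
      intro t ht
      have htI := Ioo_subset_Icc_self ht
      have hgoal : K * (c ^ (2 * i) * (c * N t * Y t)) ≤ -(K * (c ^ (2 * i) * Y2 t)) := by
        rw [← mul_neg, ← mul_neg]
        exact mul_le_mul_of_nonneg_left (mul_le_mul_of_nonneg_left (hY2 t ht)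
          (pow_pos hc _).le) hK.le
      refine le_trans ?_ hgoal
      rcases Nat.lt_or_ge (2 * i + 1 + 1) r with h | h
      · have h1 := hb (i + 1) (by omega) t htI
        have h2 : ‖U (2 * i + 1 + 1) t‖ ≤ K * (c ^ (2 * (i + 1)) * Y t) := h1
        refine h2.trans ?_
        apply mul_le_mul_of_nonneg_left _ hK.le
        have e : c ^ (2 * (i + 1)) * Y t = c ^ (2 * i) * (c * c * Y t) := by ring
        rw [e]
        apply mul_le_mul_of_nonneg_left _ (pow_pos hc _).le
        apply mul_le_mul_of_nonneg_right _ (hYpos t).le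
        exact mul_le_mul_of_nonneg_left (hcN t) hc.le
      · have e : 2 * i + 1 + 1 = r := by omega
        rw [e]
        have h1 := hb 0 (by omega) t htI
        have h2 : ‖U 0 t‖ ≤ K * Y t := by simpa using h1
        refine (hle t).trans ?_
        have e3 : r - 1 = 2 * i + 1 := by omega
        rw [e3]
        refine (mul_le_mul_of_nonneg_left h2 (mul_pos (pow_pos hc _) (hN0 t)).le).trans ?_
        apply le_of_eq
        ring
  · rcases Nat.eq_zero_or_pos k with h0 | hk0
    · -- r = 1
      subst h0
      simp only [mul_zero, zero_add] at hk
      subst hk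
      obtain ⟨Y, hY⟩ : ∃ Y : ℝ → ℝ, Y = fun t => Real.exp (∫ s in a..t, N s) := ⟨_, rfl⟩
      have hYd : ∀ t, HasDerivAt Y (Y t * N t) t := fun t => by
        rw [hY]
        exact (hN.integral_hasStrictDerivAt a t).hasDerivAt.exp
      have hYc : Continuous Y := continuous_iff_continuousAt.2 fun t => (hYd t).continuousAt
      have hYpos : ∀ t, 0 < Y t := fun t => by rw [hY]; exact Real.exp_pos _
      have hYa : Y a = 1 := by rw [hY]; simp
      apply aux_sup hab 0 U (fun i t => Y t)
      · intro i hi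
        exact (hUc _ (by omega)).continuousOn
      · intro i hi
        exact hYc.continuousOn
      · intro i hi t ht
        exact hYpos t
      · intro K hK hb i hi t ht
        have hi0 : i = 0 := by omega
        subst hi0
        have h1 := aux_first (U 0) (U 1) (hU 0 (by omega)) hUr (fun s => K * (Y s * N s))
          (by fun_prop) ht.1 (by
            intro s hs
            refine (hle s).trans ?_
            have h2 := mul_le_mul_of_nonneg_left
              (hb 0 le_rfl s ⟨hs.1, hs.2.trans ht.2⟩) (hN0 s).le
            simp only [Nat.sub_self, pow_zero, one_mul]
            linarith)
        rw [intervalIntegral.integral_const_mul,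
          intervalIntegral.integral_eq_sub_of_hasDerivAt (fun s _ => hYd s)
          (Continuous.intervalIntegrable (by fun_prop) _ _), hYa] at h1
        have h3 : U 0 a = 0 := hUa 0 (by omega)
        rw [h3, sub_zero] at h1
        linarith
    · -- odd case, r ≥ 3
      obtain ⟨α, β, hcβ, hψpos, hmin⟩ := aux_min hab hc N hN hcN hS
      have hβ0 : 0 < β := hc.trans_le hcβ
      apply aux_sup hab k (fun i => U (2 * i))
        (fun i t => β ^ (2 * i) * Real.sin (α + β * (t - a)))
      · intro i hi
        exact (hUc _ (by omega)).continuousOn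
      · intro i hi
        fun_prop
      · intro i hi t ht
        exact mul_pos (pow_pos hβ0 _) (hψpos t ht)
      · intro K hK hb i hi
        rcases Nat.lt_or_ge i k with hik | hik
        · have hx : ∀ s, HasDerivAt (fun s => α + β * (s - a)) β s := fun s => by
            simpa using (((hasDerivAt_id s).sub_const a).const_mul β).const_add α
          apply aux_one_step hab (U (2 * i)) (U (2 * i + 1)) (U (2 * i + 1 + 1))
            (fun t => K * (β ^ (2 * i) * Real.sin (α + β * (t - a))))
            (fun t => K * (β ^ (2 * i) * (Real.cos (α + β * (t - a)) * β)))
            (fun t => K * (β ^ (2 * i) * (- Real.sin (α + β * (t - a)) * β * β)))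
            (hU _ (by omega)) (hU _ (by omega)) (by fun_prop)
            (fun t ht => ((hx t).sin.const_mul _).const_mul _)
            (fun t ht => (((hx t).cos.mul_const _).const_mul _).const_mul _) _
            (hUa i (by omega)) (hUb i (by omega))
            (mul_pos hK (mul_pos (pow_pos hβ0 _) (hψpos a haI)))
            (mul_pos hK (mul_pos (pow_pos hβ0 _) (hψpos b hbI)))
          intro t ht
          have h1 : ‖U (2 * i + 1 + 1) t‖ ≤ K * (β ^ (2 * (i + 1)) * Real.sin (α + β * (t - a))) :=
            hb (i + 1) (by omega) t (Ioo_subset_Icc_self ht)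
          refine h1.trans (le_of_eq ?_)
          ring
        · have hi' : i = k := by omega
          subst hi'
          intro t ht
          have hB : ∀ s ∈ Icc a b, ‖U (2 * i + 1) s‖ ≤
              c ^ (2 * i) * K * (N s * Real.sin (α + β * (s - a))) := by
            intro s hs
            have h1 := hle s
            have h2 : ‖U 0 s‖ ≤ K * Real.sin (α + β * (s - a)) := by
              simpa using hb 0 (by omega) s hs
            rw [hk, Nat.add_sub_cancel] at h1
            refine h1.trans ?_
            refine (mul_le_mul_of_nonneg_left h2 (mul_pos (pow_pos hc _) (hN0 s)).le).trans ?_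
            apply le_of_eq
            ring
          have hUr' : Continuous (U (2 * i + 1)) := hk ▸ hUr
          have hfin : ∀ J : ℝ, J < (β / c) ^ 2 * Real.sin (α + β * (t - a)) →
              ‖U (2 * i) t‖ ≤ c ^ (2 * i) * K * J →
              ‖U (2 * i) t‖ < K * (β ^ (2 * i) * Real.sin (α + β * (t - a))) := by
            intro J hJ h1
            have hcK : 0 < c ^ (2 * i) * K := mul_pos (pow_pos hc _) hK
            refine (h1.trans_lt (mul_lt_mul_of_pos_left hJ hcK)).trans_le ?_
            have h2 : (β / c) ^ 2 ≤ (β / c) ^ (2 * i) :=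
              pow_le_pow_right₀ (by rw [le_div_iff₀ hc]; linarith) (by omega)
            have h3 := mul_le_mul_of_nonneg_left
              (mul_le_mul_of_nonneg_right h2 (hψpos t ht).le) hcK.le
            refine h3.trans (le_of_eq ?_)
            rw [div_pow]
            field_simp
          rcases hmin t ht with h | h
          · apply hfin _ h
            have h1 := aux_first (U (2 * i)) (U (2 * i + 1)) (hU _ (by omega)) hUr' _
              (by fun_prop) ht.1 (fun s hs => hB s ⟨hs.1, hs.2.trans ht.2⟩)
            rw [hUa i (by omega), sub_zero, intervalIntegral.integral_const_mul] at h1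
            exact h1
          · apply hfin _ h
            have h1 := aux_first (U (2 * i)) (U (2 * i + 1)) (hU _ (by omega)) hUr' _
              (by fun_prop) ht.2 (fun s hs => hB s ⟨ht.1.trans hs.1, hs.2⟩)
            rw [hUb i (by omega), zero_sub, norm_neg, intervalIntegral.integral_const_mul] at h1
            exact h1

end Aux

/-- Theorem 8 of the paper, odd case (4.2)/(4.4). Consider
`z⁽ʳ⁾ = f(z, t) + p(t)` on `ℂⁿ` with an arbitrary norm (modelled as a space `E` linearly
identified with `Fin n → ℂ`), where `f` is `T`-periodic in `t`, vanishes at `z = 0`,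
satisfies the symmetry `f(z, t) = f(−z, −t)` and is Lipschitz with continuous nonnegative
coefficient `L(t)`, and `p` is continuous, `T`-periodic and even. If for some `c > 0`,
`∫₀ᵀ max (c, c^{1−r} L t) dt < 2π`, then there is at most one odd `T`-periodic solution. -/
theorem unique_odd_periodic_solution
    (n : ℕ) (hn : 1 ≤ n) {E : Type*} [NormedAddCommGroup E] [NormedSpace ℂ E]
    (coords : E ≃ₗ[ℂ] (Fin n → ℂ))
    (r : ℕ) (hr : 1 ≤ r) (T : ℝ) (hT : 0 < T)
    (f : E → ℝ → E)
    (hfper : ∀ x t, f x (t + T) = f x t)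
    (hf0 : ∀ t, f 0 t = 0)
    (hfsym : ∀ x t, f x t = f (-x) (-t))
    (L : ℝ → ℝ) (hLcont : Continuous L) (hLnonneg : ∀ t, 0 ≤ L t)
    (hLip : ∀ x y t, ‖f x t - f y t‖ ≤ L t * ‖x - y‖)
    (p : ℝ → E) (hpcont : Continuous p)
    (hpper : ∀ t, p (t + T) = p t)
    (hpeven : ∀ t, p (-t) = p t)
    (c : ℝ) (hc : 0 < c)
    (hN : (∫ t in (0:ℝ)..T, max c (c ^ (1 - (r : ℤ)) * L t)) < 2 * Real.pi)
    (z₁ z₂ : ℝ → E)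
    (hz₁sm : ContDiff ℝ r z₁) (hz₂sm : ContDiff ℝ r z₂)
    (hz₁ : ∀ t, iteratedDeriv r z₁ t = f (z₁ t) t + p t)
    (hz₂ : ∀ t, iteratedDeriv r z₂ t = f (z₂ t) t + p t)
    (hz₁odd : ∀ t, z₁ t = -z₁ (-t)) (hz₂odd : ∀ t, z₂ t = -z₂ (-t))
    (hz₁per : ∀ t, z₁ (t + T) = z₁ t) (hz₂per : ∀ t, z₂ (t + T) = z₂ t) :
    z₁ = z₂ := by
  have : FiniteDimensional ℂ E := coords.symm.finiteDimensional
  have : CompleteSpace E := FiniteDimensional.complete ℂ E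
  obtain ⟨u, hu⟩ : ∃ u : ℝ → E, u = z₁ - z₂ := ⟨_, rfl⟩
  have husm : ContDiff ℝ r u := by rw [hu]; exact hz₁sm.sub hz₂sm
  obtain ⟨N, hNdef⟩ : ∃ N : ℝ → ℝ, N = fun t => max c (c ^ (1 - (r : ℤ)) * L t) := ⟨_, rfl⟩
  have hNc : Continuous N := by rw [hNdef]; fun_prop
  have hcN : ∀ t, c ≤ N t := fun t => by rw [hNdef]; exact le_max_left _ _
  have hodd : ∀ t, u (-t) = - u t := fun t => by
    rw [hu]
    simp only [Pi.sub_apply]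
    rw [hz₁odd t, hz₂odd t]
    abel
  have hper : Function.Periodic u T := fun t => by
    rw [hu]
    simp only [Pi.sub_apply]
    rw [hz₁per t, hz₂per t]
  have hU : ∀ i < r, ∀ t, HasDerivAt (iteratedDeriv i u) (iteratedDeriv (i + 1) u t) t := by
    intro i hi t
    rw [iteratedDeriv_succ]
    exact (husm.differentiable_iteratedDeriv i (by exact_mod_cast hi) t).hasDerivAt
  have hUr : Continuous (iteratedDeriv r u) := husm.continuous_iteratedDeriv r le_rfl
  have hle : ∀ t, ‖iteratedDeriv r u t‖ ≤ c ^ (r - 1) * N t * ‖iteratedDeriv 0 u t‖ := by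
    intro t
    rw [hu, iteratedDeriv_sub hz₁sm.contDiffAt hz₂sm.contDiffAt, hz₁, hz₂, add_sub_add_right_eq_sub,
      iteratedDeriv_zero]
    refine (hLip _ _ t).trans ?_
    apply mul_le_mul_of_nonneg_right _ (norm_nonneg _)
    have h1 : c ^ (1 - (r : ℤ)) * L t ≤ N t := by rw [hNdef]; exact le_max_right _ _
    have h2 := mul_le_mul_of_nonneg_left h1 (pow_pos hc (r - 1)).le
    have h3 : c ^ (r - 1) * (c ^ (1 - (r : ℤ)) * L t) = L t := by
      rw [← mul_assoc, ← zpow_natCast c (r - 1), ← zpow_add₀ hc.ne']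
      have : ((r - 1 : ℕ) : ℤ) + (1 - (r : ℤ)) = 0 := by omega
      rw [this, zpow_zero, one_mul]
    linarith
  -- even derivatives vanish at symmetry points
  have hzero : ∀ x : ℝ, (∀ t, u (2 * x - t) = - u t) → ∀ i, iteratedDeriv (2 * i) u x = 0 := by
    intro x hx i
    have h1 : (fun t => u (2 * x - t)) = - u := by
      ext t; simp [hx t]
    have h2 := congrFun (iteratedDeriv_comp_const_sub (𝕜 := ℝ) (2 * i) u (2 * x)) x
    rw [h1, iteratedDeriv_neg] at h2
    have e : 2 * x - x = x := by ring
    simp only [e, pow_mul, neg_one_sq, one_pow, one_smul] at h2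
    have h3 : (2 : ℝ) • iteratedDeriv (2 * i) u x = 0 := by
      rw [two_smul]
      nth_rewrite 1 [← h2]
      simp
    exact (smul_eq_zero.1 h3).resolve_left two_ne_zero
  have hz0 := hzero 0 (fun t => by rw [mul_zero, zero_sub]; exact hodd t)
  have hzM := hzero (T / 2) (fun t => by
    have e : 2 * (T / 2) - t = -t + T := by ring
    rw [e, hper, hodd])
  have hzT := hzero T (fun t => by
    have e : 2 * T - t = -t + T + T := by ring
    rw [e, hper, hper, hodd])
  have hsplit : (∫ t in (0:ℝ)..(T/2), N t) + (∫ t in (T/2)..T, N t) < 2 * Real.pi := by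
    rw [intervalIntegral.integral_add_adjacent_intervals (hNc.intervalIntegrable _ _)
      (hNc.intervalIntegrable _ _), hNdef]
    exact hN
  have hhalf : ∀ t ∈ Set.Icc 0 (T / 2), u t = 0 := by
    rcases lt_or_ge (∫ t in (0:ℝ)..(T/2), N t) Real.pi with h | h
    · have := aux_core (half_pos hT) hc N hNc hcN h r hr (fun i => iteratedDeriv i u) hU hUr
        (fun i _ => hz0 i) (fun i _ => hzM i) hle
      simpa only [iteratedDeriv_zero] using this
    · have h2 := aux_core (half_lt_self hT) hc N hNc hcN (by linarith) r hr
        (fun i => iteratedDeriv i u) hU hUr (fun i _ => hzM i) (fun i _ => hzT i) hle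
      simp only [iteratedDeriv_zero] at h2
      intro t ht
      have h3 := h2 (-t + T) ⟨by linarith [ht.2], by linarith [ht.1]⟩
      rw [hper, hodd] at h3
      exact neg_eq_zero.1 h3
  have hfull : ∀ t ∈ Set.Ico 0 T, u t = 0 := by
    intro t ht
    rcases le_total t (T / 2) with h | h
    · exact hhalf t ⟨ht.1, h⟩
    · have h3 := hhalf (-t + T) ⟨by linarith [ht.2], by linarith⟩
      rw [hper, hodd] at h3
      exact neg_eq_zero.1 h3
  ext t
  obtain ⟨y, hy, hty⟩ := hper.exists_mem_Ico₀ hT t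
  have h4 : u t = 0 := by rw [hty]; exact hfull y hy
  rw [hu] at h4
  exact sub_eq_zero.1 h4
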